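/- Let q be a prime power and n ≥ 1. Among all transvections in GL_{2n}(F_q), the proportion lying in Sp_{2n}(F_q) equals (q−1)/(q^{2n−1}−1), and the proportion not lying in Sp_{2n}(F_q) equals q(q^{2n−2}−1)/(q^{2n−1}−1). That is, (number of symplectic transvections)·(q^{2n−1}−1) = (q−1)·(total number of transvections), and (number of non-symplectic transvections)·(q^{2n−1}−1) = q(q^{2n−2}−1)·(total number of transvections). -/

import Mathlib

open Matrix

noncomputable section

variable (F : Type) [Field F] [Fintype F] [DecidableEq F]

/-- The Gram matrix `J = [[0, I], [-I, 0]]` of the standard symplectic form on `F^(2n)`. -/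
def Jmat (n : ℕ) : Matrix (Fin (2 * n)) (Fin (2 * n)) F :=
  Matrix.of fun i j =>
    if (j : ℕ) = (i : ℕ) + n then 1 else if (i : ℕ) = (j : ℕ) + n then -1 else 0

/-- `g ∈ GL_m(F)` is a transvection: `g ≠ I`, `rank (g - I) = 1` and `(g - I)^2 = 0`. -/
def IsTransvection {m : ℕ} (g : GL (Fin m) F) : Prop :=
  g ≠ 1 ∧ ((g : Matrix (Fin m) (Fin m) F) - 1).rank = 1 ∧
    ((g : Matrix (Fin m) (Fin m) F) - 1) ^ 2 = 0

/-- Membership in the symplectic group `Sp_{2n}(F)`: `gᵀ J g = J`. -/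
def InSp {n : ℕ} (g : GL (Fin (2 * n)) F) : Prop :=
  (g : Matrix (Fin (2 * n)) (Fin (2 * n)) F)ᵀ * Jmat F n *
    (g : Matrix (Fin (2 * n)) (Fin (2 * n)) F) = Jmat F n

theorem exists_eq_vecMulVec_of_rank_eq_one {K m n : Type*} [Field K] [Fintype m] [Fintype n]
    {A : Matrix m n K} (h : A.rank = 1) : ∃ v f, A = vecMulVec v f := by
  classical
  rw [Matrix.rank, finrank_eq_one_iff'] at h
  obtain ⟨v, -, hv⟩ := h
  choose c hc using hv
  refine ⟨v, fun j => c ⟨A *ᵥ Pi.single j 1, ⟨_, rfl⟩⟩, ?_⟩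
  ext i j
  have := congrFun (congrArg Subtype.val (hc ⟨A *ᵥ Pi.single j 1, ⟨_, rfl⟩⟩)) i
  simp only [Submodule.coe_smul, Pi.smul_apply, smul_eq_mul, mulVec_single_one, col_apply] at this
  rw [vecMulVec_apply, mul_comm]
  simpa using this.symm

theorem exists_smul_of_vecMulVec_eq {K m n : Type*} [Field K] {v v' : m → K} {f f' : n → K}
    (hv : v ≠ 0) (hf : f ≠ 0) (h : vecMulVec v f = vecMulVec v' f') :
    ∃ c : Kˣ, v' = c • v ∧ f' = c⁻¹ • f := by
  have h (i j) : v i * f j = v' i * f' j := congrFun (congrFun h i) j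
  obtain ⟨i, hi⟩ := Function.ne_iff.1 hv
  obtain ⟨j, hj⟩ := Function.ne_iff.1 hf
  simp only [Pi.zero_apply] at hi hj
  have hj' : f' j ≠ 0 := right_ne_zero_of_mul (h i j ▸ mul_ne_zero hi hj)
  have hv' (k) : v' k = f j / f' j * v k := by
    rw [div_mul_eq_mul_div, eq_div_iff hj', ← h, mul_comm]
  refine ⟨Units.mk0 (f j / f' j) (div_ne_zero hj hj'),
    funext fun k => by simp [hv', Units.smul_def], funext fun k => ?_⟩
  have hw := h i k
  rw [hv', mul_assoc, mul_left_comm, mul_right_inj' hi] at hw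
  simp only [Units.smul_def, Pi.smul_apply, Units.val_inv_eq_inv_val, Units.val_mk0, smul_eq_mul]
  rw [hw, inv_mul_cancel_left₀ (div_ne_zero hj hj')]

/-- The unit `1 + v fᵀ`, for `fᵀ v = 0`. -/
def transvectionUnit {K n : Type*} [Field K] [Fintype n] [DecidableEq n] (v f : n → K)
    (h : f ⬝ᵥ v = 0) : GL n K where
  val := 1 + vecMulVec v f
  inv := 1 - vecMulVec v f
  val_inv := by
    rw [add_mul, mul_sub, mul_sub, vecMulVec_mul_vecMulVec, h]
    simp
  inv_val := by
    rw [sub_mul, mul_add, mul_add, vecMulVec_mul_vecMulVec, h]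
    simp

omit [Fintype F] [DecidableEq F] in
theorem exists_vecMulVec_of_isTransvection {m : ℕ} {g : GL (Fin m) F} (hg : IsTransvection F g) :
    ∃ v f : Fin m → F, v ≠ 0 ∧ f ≠ 0 ∧ f ⬝ᵥ v = 0 ∧
      (g : Matrix (Fin m) (Fin m) F) = 1 + vecMulVec v f := by
  obtain ⟨-, h1, h2⟩ := hg
  obtain ⟨v, f, hA⟩ := exists_eq_vecMulVec_of_rank_eq_one h1
  have hvf : vecMulVec v f ≠ 0 := by
    intro h0
    rw [hA, h0, rank_zero] at h1
    exact zero_ne_one h1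
  obtain ⟨hv, hf⟩ := not_or.1 (vecMulVec_eq_zero.not.1 hvf)
  refine ⟨v, f, hv, hf, ?_, by rw [← hA]; abel⟩
  rw [hA, sq, vecMulVec_mul_vecMulVec, vecMulVec_eq_zero] at h2
  simpa [hv, hf] using h2

omit [Fintype F] [DecidableEq F] in
theorem isTransvection_transvectionUnit {m : ℕ} {v f : Fin m → F} (hv : v ≠ 0) (hf : f ≠ 0)
    (h : f ⬝ᵥ v = 0) : IsTransvection F (transvectionUnit v f h) := by
  have hval : ((transvectionUnit v f h : GL (Fin m) F) : Matrix (Fin m) (Fin m) F) - 1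
      = vecMulVec v f := add_sub_cancel_left _ _
  have hne : vecMulVec v f ≠ 0 := vecMulVec_ne_zero hv hf
  refine ⟨fun h1 => hne ?_, le_antisymm ?_ ?_, ?_⟩
  · rw [← hval, h1]
    simp
  · rw [hval]
    exact rank_vecMulVec_le _ _
  · rw [hval, Nat.one_le_iff_ne_zero, Matrix.rank, Ne, Submodule.finrank_eq_zero,
      LinearMap.range_eq_bot]
    exact fun h0 => hne ((toLin' (R := F)).map_eq_zero_iff.1 h0)
  · rw [hval, sq, vecMulVec_mul_vecMulVec, h]
    simp

/-- Every transvection is `1 + v fᵀ` for exactly `q - 1` pairs `(v, f)`. -/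
theorem card_isTransvection_mul {m : ℕ} (Q : Matrix (Fin m) (Fin m) F → Prop) :
    Nat.card {g : GL (Fin m) F // IsTransvection F g ∧ Q g} * (Fintype.card F - 1) =
      Nat.card {p : (Fin m → F) × (Fin m → F) //
        p.1 ≠ 0 ∧ p.2 ≠ 0 ∧ p.2 ⬝ᵥ p.1 = 0 ∧ Q (1 + vecMulVec p.1 p.2)} := by
  rw [← Fintype.card_units, ← Nat.card_eq_fintype_card (α := Fˣ), ← Nat.card_prod]
  choose v f hv hf hvf hg using
    fun g : {g : GL (Fin m) F // IsTransvection F g ∧ Q g} =>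
      exists_vecMulVec_of_isTransvection F g.2.1
  have hsmul (g) (c : Fˣ) : vecMulVec (c • v g) (c⁻¹ • f g) = vecMulVec (v g) (f g) := by
    rw [smul_vecMulVec, vecMulVec_smul, smul_inv_smul]
  refine Nat.card_congr (Equiv.ofBijective (fun x => ⟨(x.2 • v x.1, x.2⁻¹ • f x.1),
    (smul_ne_zero_iff_ne _).2 (hv x.1), (smul_ne_zero_iff_ne _).2 (hf x.1), by simp [hvf],
    by rw [hsmul, ← hg]; exact x.1.2.2⟩) ⟨?_, ?_⟩)
  · rintro ⟨g, c⟩ ⟨g', c'⟩ h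
    obtain ⟨h1, h2⟩ := Prod.ext_iff.1 (Subtype.ext_iff.1 h)
    simp only at h1 h2
    obtain rfl : g = g' := Subtype.ext <| Units.ext <| by
      rw [hg, hg, ← hsmul g c, ← hsmul g' c', h1, h2]
    simp only [Units.smul_def] at h1
    rw [Units.ext (smul_left_injective F (hv g) h1)]
  · rintro ⟨⟨w, k⟩, hw, hk, hwk, hQ⟩
    let g : {g : GL (Fin m) F // IsTransvection F g ∧ Q g} :=
      ⟨transvectionUnit w k hwk, isTransvection_transvectionUnit F hw hk hwk, hQ⟩
    obtain ⟨c, hc, hc'⟩ := exists_smul_of_vecMulVec_eq (hv g) (hf g)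
      (add_left_cancel ((hg g).symm.trans rfl : _ = 1 + vecMulVec w k))
    exact ⟨(g, c), Subtype.ext (Prod.ext hc.symm hc'.symm)⟩

theorem card_ne_zero {V : Type*} [AddGroup V] [Finite V] :
    Nat.card {v : V // v ≠ 0} = Nat.card V - 1 := by
  classical
  have := Fintype.ofFinite V
  rw [Nat.card_eq_fintype_card, Nat.card_eq_fintype_card, Fintype.card_subtype_compl]
  simp

omit [DecidableEq F] in
theorem card_dotProduct_eq_zero {m : ℕ} {v : Fin m → F} (hv : v ≠ 0) :
    Nat.card {f : Fin m → F // f ≠ 0 ∧ f ⬝ᵥ v = 0} = Fintype.card F ^ (m - 1) - 1 := by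
  let φ : Module.Dual F (Fin m → F) := dotProductBilin F F v
  have hφ : φ ≠ 0 := fun h => hv (dotProduct_eq_zero v fun w => LinearMap.congr_fun h w)
  have hrank := Module.Dual.finrank_ker_add_one_of_ne_zero hφ
  rw [Module.finrank_fin_fun] at hrank
  have hcard : Nat.card (LinearMap.ker φ) = Fintype.card F ^ (m - 1) := by
    rw [Module.natCard_eq_pow_finrank (K := F), Nat.card_eq_fintype_card,
      Nat.eq_sub_of_add_eq hrank]
  rw [← hcard, ← card_ne_zero]
  refine Nat.card_congr ⟨fun f => ⟨⟨f.1, ?_⟩, ?_⟩, fun f => ⟨f.1.1, ?_, ?_⟩, fun _ => rfl,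
    fun _ => rfl⟩
  · exact (dotProduct_comm _ _).trans f.2.2
  · exact fun h => f.2.1 (Subtype.ext_iff.1 h)
  · exact fun h => f.2 (Subtype.ext h)
  · exact (dotProduct_comm _ _).trans f.1.2

theorem card_orthogonal_pairs (m : ℕ) :
    Nat.card {p : (Fin m → F) × (Fin m → F) // p.1 ≠ 0 ∧ p.2 ≠ 0 ∧ p.2 ⬝ᵥ p.1 = 0} =
      (Fintype.card F ^ m - 1) * (Fintype.card F ^ (m - 1) - 1) := by
  let e : {p : (Fin m → F) × (Fin m → F) // p.1 ≠ 0 ∧ p.2 ≠ 0 ∧ p.2 ⬝ᵥ p.1 = 0} ≃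
      Σ v : {v : Fin m → F // v ≠ 0}, {f : Fin m → F // f ≠ 0 ∧ f ⬝ᵥ v.1 = 0} :=
    ⟨fun p => ⟨⟨p.1.1, p.2.1⟩, ⟨p.1.2, p.2.2⟩⟩, fun x => ⟨(x.1.1, x.2.1), x.1.2, x.2.2⟩,
      fun _ => rfl, fun _ => rfl⟩
  rw [Nat.card_congr e, Nat.card_sigma, Finset.sum_congr rfl fun v _ =>
    card_dotProduct_eq_zero F v.2, Finset.sum_const, smul_eq_mul, Finset.card_univ,
    ← Nat.card_eq_fintype_card, card_ne_zero]
  simp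

/-- For an alternating `J`, the transvection `1 + v fᵀ` preserves `J` iff `f` is a multiple
of `J v`. -/
theorem transpose_mul_mul_eq_iff {K n : Type*} [Field K] [Fintype n] [DecidableEq n]
    {J : Matrix n n K} (hJ : Jᵀ = -J) (halt : ∀ v, v ⬝ᵥ J *ᵥ v = 0) {v f : n → K}
    (hv : J *ᵥ v ≠ 0) :
    (1 + vecMulVec v f)ᵀ * J * (1 + vecMulVec v f) = J ↔ ∃ c : K, f = c • (J *ᵥ v) := by
  have hvJ : v ᵥ* J = -(J *ᵥ v) := by
    rw [← mulVec_transpose, hJ, neg_mulVec]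
  have key : (1 + vecMulVec v f)ᵀ * J * (1 + vecMulVec v f) =
      J + (vecMulVec (J *ᵥ v) f - vecMulVec f (J *ᵥ v)) := by
    rw [transpose_add, transpose_one, transpose_vecMulVec, add_mul, one_mul, vecMulVec_mul, hvJ,
      mul_add, mul_one, add_mul, mul_vecMulVec, vecMulVec_mul_vecMulVec, neg_dotProduct,
      dotProduct_comm, halt, vecMulVec_neg]
    simp
    abel
  rw [key, add_eq_left, sub_eq_zero]
  constructor
  · intro h
    obtain ⟨j, hj⟩ := Function.ne_iff.1 hv
    refine ⟨f j / (J *ᵥ v) j, funext fun i => ?_⟩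
    have hij : (J *ᵥ v) i * f j = f i * (J *ᵥ v) j := congrFun (congrFun h i) j
    rw [Pi.smul_apply, smul_eq_mul, div_mul_eq_mul_div, eq_div_iff hj, ← hij, mul_comm]
  · rintro ⟨c, rfl⟩
    rw [smul_vecMulVec, vecMulVec_smul]

/-- The identification of the index set of `Jmat` with two copies of `Fin n`. -/
def finSumEquiv (n : ℕ) : Fin n ⊕ Fin n ≃ Fin (2 * n) :=
  finSumFinEquiv.trans (finCongr (two_mul n).symm)

omit [Fintype F] [DecidableEq F] in
theorem Jmat_eq_submatrix (n : ℕ) :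
    Jmat F n = (-Matrix.J (Fin n) F).submatrix (finSumEquiv n).symm (finSumEquiv n).symm := by
  ext i j
  obtain ⟨i, rfl⟩ := (finSumEquiv n).surjective i
  obtain ⟨j, rfl⟩ := (finSumEquiv n).surjective j
  rw [submatrix_apply, Equiv.symm_apply_apply, Equiv.symm_apply_apply]
  rcases i with i | i <;> rcases j with j | j <;>
    simp [Jmat, finSumEquiv, Matrix.J, Matrix.one_apply, Fin.ext_iff] <;> grind

omit [Fintype F] [DecidableEq F] in
theorem Jmat_transpose (n : ℕ) : (Jmat F n)ᵀ = -Jmat F n := by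
  rw [Jmat_eq_submatrix, transpose_submatrix, transpose_neg, J_transpose]
  rfl

omit [Fintype F] [DecidableEq F] in
theorem Jmat_mul_self (n : ℕ) : Jmat F n * Jmat F n = -1 := by
  rw [Jmat_eq_submatrix, submatrix_mul_equiv, neg_mul_neg, J_squared, submatrix_neg,
    Pi.neg_apply, Pi.neg_apply, submatrix_one_equiv]

omit [Fintype F] [DecidableEq F] in
theorem dotProduct_Jmat_mulVec_self (n : ℕ) (v : Fin (2 * n) → F) :
    v ⬝ᵥ Jmat F n *ᵥ v = 0 := by
  rw [Jmat_eq_submatrix, submatrix_mulVec_equiv, Equiv.symm_symm,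
    ← comp_equiv_dotProduct_comp_equiv _ _ (finSumEquiv n)]
  simp [Matrix.J, dotProduct, mulVec, neg_mulVec, Fintype.sum_sum_type, Matrix.one_apply, mul_comm]

omit [Fintype F] [DecidableEq F] in
theorem Jmat_mulVec_ne_zero {n : ℕ} {v : Fin (2 * n) → F} (hv : v ≠ 0) : Jmat F n *ᵥ v ≠ 0 := by
  intro h
  have := congrArg (Jmat F n *ᵥ ·) h
  simp only [mulVec_mulVec, Jmat_mul_self, neg_mulVec, one_mulVec, mulVec_zero] at this
  exact hv (neg_eq_zero.1 this)

theorem card_symplectic_pairs (n : ℕ) :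
    Nat.card {p : (Fin (2 * n) → F) × (Fin (2 * n) → F) // p.1 ≠ 0 ∧ p.2 ≠ 0 ∧ p.2 ⬝ᵥ p.1 = 0 ∧
      (1 + vecMulVec p.1 p.2)ᵀ * Jmat F n * (1 + vecMulVec p.1 p.2) = Jmat F n} =
      (Fintype.card F ^ (2 * n) - 1) * (Fintype.card F - 1) := by
  have hV : Nat.card {v : Fin (2 * n) → F // v ≠ 0} = Fintype.card F ^ (2 * n) - 1 := by
    rw [card_ne_zero]
    simp
  rw [← hV, ← Fintype.card_units, ← Nat.card_eq_fintype_card (α := Fˣ), ← Nat.card_prod]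
  have hiff {v : Fin (2 * n) → F} (hv : v ≠ 0) (f) :=
    transpose_mul_mul_eq_iff (f := f) (Jmat_transpose F n) (dotProduct_Jmat_mulVec_self F n)
      (Jmat_mulVec_ne_zero F hv)
  symm
  refine Nat.card_congr (Equiv.ofBijective (fun x => ⟨(x.1.1, x.2 • (Jmat F n *ᵥ x.1.1)),
    x.1.2, (smul_ne_zero_iff_ne _).2 (Jmat_mulVec_ne_zero F x.1.2), ?_,
    (hiff x.1.2 _).2 ⟨x.2, rfl⟩⟩) ⟨?_, ?_⟩)
  · rw [smul_dotProduct, dotProduct_comm, dotProduct_Jmat_mulVec_self, smul_zero]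
  · rintro ⟨⟨v, hv⟩, c⟩ ⟨⟨w, hw⟩, d⟩ h
    obtain ⟨h1, h2⟩ := Prod.ext_iff.1 (Subtype.ext_iff.1 h)
    simp only at h1 h2
    subst h1
    simp only [Units.smul_def] at h2
    rw [Units.ext (smul_left_injective F (Jmat_mulVec_ne_zero F hv) h2)]
  · rintro ⟨⟨v, f⟩, hv, hf, -, hQ⟩
    dsimp only at hv hf hQ
    obtain ⟨c, rfl⟩ := (hiff hv f).1 hQ
    exact ⟨(⟨v, hv⟩, Units.mk0 c (left_ne_zero_of_smul hf)), rfl⟩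

/-- Proportions of symplectic and non-symplectic transvections among all transvections in
`GL_{2n}(F_q)`: with `q = |F|`,
`(#symplectic transvections)·(q^{2n−1}−1) = (q−1)·(#transvections)` and
`(#non-symplectic transvections)·(q^{2n−1}−1) = q(q^{2n−2}−1)·(#transvections)`. -/
theorem proportion_symplectic_transvections (n : ℕ) (hn : 1 ≤ n) :
    Nat.card {g : GL (Fin (2 * n)) F // IsTransvection F g ∧ InSp F g} *
        (Fintype.card F ^ (2 * n - 1) - 1) =
      (Fintype.card F - 1) * Nat.card {g : GL (Fin (2 * n)) F // IsTransvection F g} ∧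
    Nat.card {g : GL (Fin (2 * n)) F // IsTransvection F g ∧ ¬ InSp F g} *
        (Fintype.card F ^ (2 * n - 1) - 1) =
      Fintype.card F * (Fintype.card F ^ (2 * n - 2) - 1) *
        Nat.card {g : GL (Fin (2 * n)) F // IsTransvection F g} := by
  have hq : 1 < Fintype.card F := Fintype.one_lt_card
  have htot := card_isTransvection_mul F (m := 2 * n) fun _ => True
  simp only [and_true] at htot
  rw [card_orthogonal_pairs] at htot
  have hsp : Nat.card {g : GL (Fin (2 * n)) F // IsTransvection F g ∧ InSp F g} =
      Fintype.card F ^ (2 * n) - 1 :=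
    Nat.eq_of_mul_eq_mul_right (Nat.sub_pos_of_lt hq) <|
      (card_isTransvection_mul F (m := 2 * n) fun g => gᵀ * Jmat F n * g = Jmat F n).trans
        (card_symplectic_pairs F n)
  have hsplit : Nat.card {g : GL (Fin (2 * n)) F // IsTransvection F g} =
      Nat.card {g : GL (Fin (2 * n)) F // IsTransvection F g ∧ InSp F g} +
        Nat.card {g : GL (Fin (2 * n)) F // IsTransvection F g ∧ ¬ InSp F g} := by
    classical
    rw [Nat.card_congr (Equiv.subtypeSubtypeEquivSubtypeInter _ _).symm,
      Nat.card_congr (Equiv.subtypeSubtypeEquivSubtypeInter _ fun g => ¬ InSp F g).symm,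
      ← Nat.card_sum]
    exact Nat.card_congr (Equiv.sumCompl _).symm
  rw [← hsp] at htot
  have hpow : Fintype.card F ^ (2 * n - 1) = Fintype.card F * Fintype.card F ^ (2 * n - 2) := by
    rw [← pow_succ']
    congr 1
    omega
  have hpos : 0 < Fintype.card F ^ (2 * n - 2) := by positivity
  rw [hpow] at htot ⊢
  have h1 : 1 ≤ Fintype.card F * Fintype.card F ^ (2 * n - 2) := by nlinarith
  generalize Fintype.card F ^ (2 * n - 2) = r at *
  zify [hq.le, h1, (hpos : 1 ≤ r)] at htot hsplit ⊢
  constructor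
  · linear_combination -htot
  · linear_combination htot - (Fintype.card F * r - 1 : ℤ) * hsplit
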